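/- Σ_{n=1}^∞ ((4n² + 7n − 3)/((2n+1)(2n+3))) · (16ⁿ / (n³·C(2n,n)³)) = π²/6 − 4/9, where C(2n,n) denotes the central binomial coefficient. -/

import Mathlib

open Filter Topology

/-- The hypergeometric kernel `n!⁴ / ((2n+1)! · (x(x+1)⋯(x+n))²)`. -/
noncomputable def wzKernel (x : ℝ) (n : ℕ) : ℝ :=
  1 / x ^ 2 * ∏ i ∈ Finset.range n, ((i : ℝ) + 1) ^ 3 / (2 * (2 * i + 3) * (x + i + 1) ^ 2)

lemma wzKernel_succ (x : ℝ) (n : ℕ) :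
    wzKernel x (n + 1) =
      wzKernel x n * (((n : ℝ) + 1) ^ 3 / (2 * (2 * n + 3) * (x + n + 1) ^ 2)) := by
  simp only [wzKernel, Finset.prod_range_succ, mul_assoc]

lemma wzKernel_pos {x : ℝ} (hx : 0 < x) (n : ℕ) : 0 < wzKernel x n := by
  unfold wzKernel
  positivity

lemma wzKernel_add_one {x : ℝ} (hx : 0 < x) (n : ℕ) :
    wzKernel (x + 1) n = wzKernel x n * (x ^ 2 / (x + n + 1) ^ 2) := by
  induction n with
  | zero => simp [wzKernel]; field_simp
  | succ n ih =>
    rw [wzKernel_succ, wzKernel_succ, ih]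
    push_cast
    have h1 : x + 1 + n + 1 ≠ 0 := by positivity
    have h2 : x + (n + 1) + 1 ≠ 0 := by positivity
    field_simp
    ring

lemma wzKernel_le {x : ℝ} (hx : 0 < x) (n : ℕ) :
    wzKernel x n * (2 * n + 1) ≤ 1 / x ^ 2 * (1 / 2) ^ n := by
  induction n with
  | zero => simp [wzKernel]
  | succ n ih =>
    have hB := wzKernel_pos hx n
    have key : ((n : ℝ) + 1) ^ 3 / (2 * (2 * n + 3) * (x + n + 1) ^ 2) * (2 * (n + 1) + 1)
        ≤ (2 * n + 1) * (1 / 2) := by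
      rw [div_mul_eq_mul_div, div_le_iff₀ (by positivity)]
      have h : ((n : ℝ) + 1) ^ 2 ≤ (x + n + 1) ^ 2 := by gcongr; linarith
      have h' : ((n : ℝ) + 1) ^ 2 * (n + 1) ≤ (x + n + 1) ^ 2 * (2 * n + 1) := by
        gcongr; linarith [n.cast_nonneg (α := ℝ)]
      have := mul_le_mul_of_nonneg_right h' (show (0 : ℝ) ≤ 2 * n + 3 by positivity)
      nlinarith [this]
    rw [wzKernel_succ, pow_succ]
    push_cast
    calc _ = wzKernel x n * (((n : ℝ) + 1) ^ 3 / (2 * (2 * n + 3) * (x + n + 1) ^ 2)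
          * (2 * (n + 1) + 1)) := by ring
      _ ≤ wzKernel x n * ((2 * n + 1) * (1 / 2)) := by gcongr
      _ = wzKernel x n * (2 * n + 1) * (1 / 2) := by ring
      _ ≤ 1 / x ^ 2 * (1 / 2) ^ n * (1 / 2) := by gcongr
      _ = _ := by ring

/-- The terms of the accelerated series for `∑ 1 / (x + k) ^ 2`. -/
noncomputable def wzTerm (x : ℝ) (n : ℕ) : ℝ := wzKernel x n * (x + (3 * n + 1) / 2)

/-- The Wilf–Zeilberger certificate equation. -/
lemma wzTerm_sub_wzTerm_add_one {x : ℝ} (hx : 0 < x) (n : ℕ) :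
    wzTerm x n - wzTerm (x + 1) n =
      wzKernel x n * (2 * n + 1) - wzKernel x (n + 1) * (2 * (n + 1 : ℕ) + 1) := by
  rw [wzTerm, wzTerm, wzKernel_add_one hx, wzKernel_succ]
  push_cast
  have h1 : x + n + 1 ≠ 0 := by positivity
  field_simp
  ring

lemma wzTerm_nonneg {x : ℝ} (hx : 0 < x) (n : ℕ) : 0 ≤ wzTerm x n :=
  mul_nonneg (wzKernel_pos hx n).le (by positivity)

lemma wzTerm_le {x : ℝ} (hx : 0 < x) (n : ℕ) :
    wzTerm x n ≤ (x + 1) / x ^ 2 * (1 / 2) ^ n := by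
  calc wzTerm x n ≤ wzKernel x n * ((2 * n + 1) * (x + 1)) := by
        refine mul_le_mul_of_nonneg_left ?_ (wzKernel_pos hx n).le
        have : (0 : ℝ) ≤ n * x := by positivity
        nlinarith [n.cast_nonneg (α := ℝ)]
    _ = wzKernel x n * (2 * n + 1) * (x + 1) := by ring
    _ ≤ 1 / x ^ 2 * (1 / 2) ^ n * (x + 1) := mul_le_mul_of_nonneg_right (wzKernel_le hx n) (by positivity)
    _ = _ := by ring

lemma summable_wzTerm {x : ℝ} (hx : 0 < x) : Summable (wzTerm x) :=
  .of_nonneg_of_le (wzTerm_nonneg hx) (wzTerm_le hx) (summable_geometric_two.mul_left _)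

lemma tsum_wzTerm_le {x : ℝ} (hx : 0 < x) : ∑' n, wzTerm x n ≤ (x + 1) / x ^ 2 * 2 := by
  rw [← tsum_geometric_two, ← tsum_mul_left]
  exact (summable_wzTerm hx).tsum_le_tsum (wzTerm_le hx) (summable_geometric_two.mul_left _)

lemma tsum_wzTerm_sub {x : ℝ} (hx : 0 < x) :
    ∑' n, wzTerm x n - ∑' n, wzTerm (x + 1) n = 1 / x ^ 2 := by
  have hx' : 0 < x + 1 := by positivity
  have h := ((summable_wzTerm hx).hasSum.sub (summable_wzTerm hx').hasSum).tendsto_sum_nat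
  have h0 : Tendsto (fun n : ℕ => wzKernel x n * (2 * n + 1)) atTop (𝓝 0) := by
    refine squeeze_zero (fun n => mul_nonneg (wzKernel_pos hx n).le (by positivity))
      (wzKernel_le hx) ?_
    simpa only [mul_zero] using (tendsto_pow_atTop_nhds_zero_of_lt_one (r := (1 / 2 : ℝ))
      (by norm_num) (by norm_num)).const_mul (1 / x ^ 2)
  refine tendsto_nhds_unique h ?_
  simp only [wzTerm_sub_wzTerm_add_one hx]
  have e : ∀ N : ℕ, ∑ n ∈ Finset.range N, (wzKernel x n * (2 * n + 1)
      - wzKernel x (n + 1) * (2 * (n + 1 : ℕ) + 1)) =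
      1 / x ^ 2 - wzKernel x N * (2 * N + 1) := fun N => by
    rw [Finset.sum_range_sub' (fun n : ℕ => wzKernel x n * (2 * (n : ℝ) + 1))]
    simp [wzKernel]
  simp only [e]
  simpa only [sub_zero] using h0.const_sub (1 / x ^ 2)

lemma hasSum_one_div_add_sq {x : ℝ} (hx : 0 < x) :
    HasSum (fun k : ℕ => 1 / (x + k) ^ 2) (∑' n, wzTerm x n) := by
  rw [hasSum_iff_tendsto_nat_of_nonneg (fun k => by positivity)]
  have e : ∀ K : ℕ, ∑ k ∈ Finset.range K, 1 / (x + k) ^ 2 =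
      ∑' n, wzTerm x n - ∑' n, wzTerm (x + K) n := fun K => by
    have := Finset.sum_range_sub' (fun k : ℕ => ∑' n, wzTerm (x + k) n) K
    simp only [Nat.cast_zero, add_zero] at this
    rw [← this]
    refine Finset.sum_congr rfl fun k _ => ?_
    rw [← tsum_wzTerm_sub (by positivity : 0 < x + k)]
    push_cast
    simp only [add_assoc]
  simp only [e]
  have hinv : Tendsto (fun K : ℕ => (x + K)⁻¹) atTop (𝓝 0) :=
    (tendsto_atTop_add_const_left _ x tendsto_natCast_atTop_atTop).inv_tendsto_atTop
  have h0 : Tendsto (fun K : ℕ => ∑' n, wzTerm (x + K) n) atTop (𝓝 0) := by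
    refine squeeze_zero (fun K => tsum_nonneg (wzTerm_nonneg (by positivity)))
      (fun K => tsum_wzTerm_le (by positivity)) ?_
    have := (hinv.add (hinv.pow 2)).mul_const 2
    simp only [ne_eq, OfNat.ofNat_ne_zero, not_false_eq_true, zero_pow, add_zero, zero_mul] at this
    refine this.congr fun K => ?_
    have : x + K ≠ 0 := by positivity
    field_simp
  simpa using h0.const_sub (∑' n, wzTerm x n)

lemma hasSum_one_div_half_add_sq :
    HasSum (fun k : ℕ => 1 / ((1 / 2 : ℝ) + k) ^ 2) (Real.pi ^ 2 / 2) := by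
  have hodd := (hasSum_one_div_add_sq (x := 1 / 2) (by norm_num)).mul_left (1 / 4)
  have heven := hasSum_zeta_two.mul_left (1 / 4)
  have h := HasSum.even_add_odd (f := fun n : ℕ => 1 / (n : ℝ) ^ 2)
    (heven.congr_fun fun k => by push_cast; ring)
    (hodd.congr_fun fun k => by
      push_cast
      have : (0 : ℝ) < 2 * k + 1 := by positivity
      have : (0 : ℝ) < 1 / 2 + k := by positivity
      field_simp
      ring)
  have h2 := h.unique hasSum_zeta_two
  convert hasSum_one_div_add_sq (x := 1 / 2) (by norm_num) using 1
  linarith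

lemma hasSum_wzTerm_half : HasSum (wzTerm (1 / 2)) (Real.pi ^ 2 / 2) := by
  have h := hasSum_one_div_add_sq (x := 1 / 2) (by norm_num)
  rw [hasSum_one_div_half_add_sq.unique h]
  exact (summable_wzTerm (by norm_num)).hasSum

lemma sixteen_pow_div_centralBinom_cube (n : ℕ) :
    (16 : ℝ) ^ (n + 1) / (((n : ℝ) + 1) ^ 3 * ((2 * (n + 1)).choose (n + 1) : ℝ) ^ 3) =
      wzKernel (1 / 2) n / 2 := by
  rw [← Nat.centralBinom_eq_two_mul_choose]
  induction n with
  | zero => norm_num [wzKernel, Nat.centralBinom]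
  | succ n ih =>
    have hc : ((n : ℝ) + 1 + 1) * (Nat.centralBinom (n + 1 + 1)) =
        2 * (2 * (n + 1) + 1) * Nat.centralBinom (n + 1) := by
      exact_mod_cast Nat.succ_mul_centralBinom_succ (n + 1)
    have hpos : (0 : ℝ) < Nat.centralBinom (n + 1) := by
      exact_mod_cast Nat.centralBinom_pos _
    have hpos2 : (1 : ℝ) / 2 + n + 1 ≠ 0 := by positivity
    have e : (1 : ℝ) / 2 + n + 1 = (2 * n + 3) / 2 := by ring
    rw [wzKernel_succ, mul_div_right_comm, ← ih, e]
    push_cast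
    rw [← mul_pow, hc, pow_succ (16 : ℝ) (n + 1)]
    field_simp
    ring

/-- The rational Zeilberger-type series
`Σ_{n≥1} (4n²+7n−3)/((2n+1)(2n+3)) · 16ⁿ/(n³·C(2n,n)³) = π²/6 − 4/9`. -/
theorem stmt_12 :
    ∑' n : ℕ,
      (4 * ((n : ℝ) + 1) ^ 2 + 7 * ((n : ℝ) + 1) - 3) /
          ((2 * ((n : ℝ) + 1) + 1) * (2 * ((n : ℝ) + 1) + 3)) *
        (16 ^ (n + 1) / (((n : ℝ) + 1) ^ 3 * ((2 * (n + 1)).choose (n + 1) : ℝ) ^ 3)) =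
      Real.pi ^ 2 / 6 - 4 / 9 := by
  have hx : (0 : ℝ) < 1 / 2 := by norm_num
  -- The summand differs from `wzTerm (1 / 2) n / 3` by a telescoping term.
  let u : ℕ → ℝ := fun n => (2 * n + 1) ^ 2 / (3 * (2 * n + 3)) * wzKernel (1 / 2) n
  have hu : Summable u := by
    refine .of_nonneg_of_le
      (fun n => mul_nonneg (by positivity) (wzKernel_pos hx n).le) (fun n => ?_)
      (summable_wzTerm hx)
    rw [wzTerm, mul_comm (wzKernel _ _)]
    refine mul_le_mul_of_nonneg_right ?_ (wzKernel_pos hx n).le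
    rw [div_le_iff₀ (by positivity)]
    nlinarith [n.cast_nonneg (α := ℝ)]
  have hshift : HasSum (fun n => u (n + 1)) (∑' n, u n - u 0) := by
    simpa using (hasSum_nat_add_iff' 1).2 hu.hasSum
  have h := (hasSum_wzTerm_half.div_const 3).add (hshift.sub hu.hasSum)
  have hu0 : u 0 = 4 / 9 := by norm_num [u, wzKernel]
  rw [hu0] at h
  convert h.tsum_eq using 1
  · refine tsum_congr fun n => ?_
    rw [sixteen_pow_div_centralBinom_cube]
    simp only [u, wzTerm, wzKernel_succ]
    have e : (1 : ℝ) / 2 + n + 1 = (2 * n + 3) / 2 := by ring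
    rw [e]
    push_cast
    have h1 : (2 * ((n : ℝ) + 1) + 1) ≠ 0 := by positivity
    have h2 : (2 * ((n : ℝ) + 1) + 3) ≠ 0 := by positivity
    have h3 : (2 * (n : ℝ) + 3) ≠ 0 := by positivity
    field_simp
    ring
  · ring
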